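/- arXiv:1307.7456 — 2 statements merged into one kernel-verified Lean document; each statement's English description precedes it below -/
import Mathlib

section
/- Let p_0, p_1, p_2 be binary forms of degree 4 over ℂ that are linearly independent over ℂ and have no common zero in ℙ¹(ℂ), and let θ : ℙ¹(ℂ) → ℙ²(ℂ) be the induced map. Suppose x_1, x_2, x_3, x_4, x_5, x_6 are six pairwise distinct points of ℙ¹(ℂ) and z_0, z_1, z_2 are three pairwise distinct points of ℙ²(ℂ) with θ(x_1)=θ(x_2)=z_0, θ(x_3)=θ(x_4)=z_1, and θ(x_5)=θ(x_6)=z_2. Then z_0, z_1, z_2 do not lie on a common projective line, i.e., there is no nonzero linear form L on ℂ³ vanishing on representatives of all three points z_0, z_1, z_2. -/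
open MvPolynomial

/-- The map `θ : ℙ¹(ℂ) → ℙ²(ℂ)` induced by a triple of binary forms,
`[s:t] ↦ [p₀(s,t) : p₁(s,t) : p₂(s,t)]` (junk value where all three forms vanish,
which does not occur when the forms have no common zero). -/
noncomputable def projMap (p : Fin 3 → MvPolynomial (Fin 2) ℂ)
    (x : Projectivization ℂ (Fin 2 → ℂ)) : Projectivization ℂ (Fin 3 → ℂ) :=
  if h : (fun i => eval x.rep (p i)) = 0 then
    Projectivization.mk ℂ (Pi.single 0 1) (by intro h0; simpa using congrFun h0 0)
  else Projectivization.mk ℂ (fun i => eval x.rep (p i)) h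

/-- Two points of the projective line away from `[1 : 0]` with the same affine coordinate are
equal. -/
theorem projectivization_eq_of_rep_div_eq {K : Type*} [Field K]
    {P Q : Projectivization K (Fin 2 → K)} (hP : P.rep 1 ≠ 0) (hQ : Q.rep 1 ≠ 0)
    (h : P.rep 0 / P.rep 1 = Q.rep 0 / Q.rep 1) : P = Q := by
  rw [← P.mk_rep, ← Q.mk_rep, Projectivization.mk_eq_mk_iff']
  refine ⟨P.rep 1 / Q.rep 1, ?_⟩
  ext i
  rw [div_eq_div_iff hP hQ] at h
  fin_cases i
  · simp only [Pi.smul_apply, smul_eq_mul, Fin.zero_eta]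
    field_simp
    linear_combination -h
  · simp [hQ]

/-- The only point of the projective line with vanishing second coordinate is `[1 : 0]`. -/
theorem projectivization_eq_of_rep_one_eq_zero {K : Type*} [Field K]
    {P Q : Projectivization K (Fin 2 → K)} (hP : P.rep 1 = 0) (hQ : Q.rep 1 = 0) : P = Q := by
  have hQ0 : Q.rep 0 ≠ 0 := fun h0 ↦ Q.rep_nonzero <| by
    ext i
    fin_cases i <;> simpa
  rw [← P.mk_rep, ← Q.mk_rep, Projectivization.mk_eq_mk_iff']
  refine ⟨P.rep 0 / Q.rep 0, ?_⟩
  ext i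
  fin_cases i <;> simp [hP, hQ, hQ0]

/-- A homogeneous polynomial of degree `n` scales by `c ^ n` under rescaling of its variables. -/
theorem eval_smul_of_isHomogeneous {σ K : Type*} [CommSemiring K] {q : MvPolynomial σ K} {n : ℕ}
    (hq : q.IsHomogeneous n) (c : K) (v : σ → K) : eval (c • v) q = c ^ n * eval v q := by
  rw [eval_eq, eval_eq, Finset.mul_sum]
  refine Finset.sum_congr rfl fun d hd ↦ ?_
  have hdeg : ∑ i ∈ d.support, d i = n := by
    simpa [Finsupp.weight_apply, Finsupp.sum] using hq (mem_support_iff.mp hd)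
  simp only [Pi.smul_apply, smul_eq_mul, mul_pow, Finset.prod_mul_distrib,
    Finset.prod_pow_eq_pow_sum, hdeg]
  ring

/-- Evaluating the dehomogenization of a binary polynomial at `a` is evaluating the polynomial at
`(a, 1)`. -/
theorem eval_aeval_X_one {K : Type*} [CommRing K] (q : MvPolynomial (Fin 2) K) (a : K) :
    Polynomial.eval a (aeval ![(Polynomial.X : Polynomial K), 1] q) = eval ![a, 1] q := by
  have h : (fun i ↦ Polynomial.aeval a (![(Polynomial.X : Polynomial K), 1] i)) = ![a, 1] := by
    ext i
    fin_cases i <;> simp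
  rw [← Polynomial.coe_aeval_eq_eval, ← AlgHom.comp_apply, comp_aeval, h, aeval_eq_eval]

/-- A binary form whose dehomogenization vanishes is zero. -/
theorem eq_zero_of_aeval_X_one_eq_zero {K : Type*} [Field K] [Infinite K]
    {q : MvPolynomial (Fin 2) K} {n : ℕ} (hq : q.IsHomogeneous n)
    (h : aeval ![(Polynomial.X : Polynomial K), 1] q = 0) : q = 0 := by
  have heval (a : K) : eval ![a, 1] q = 0 := by
    rw [← eval_aeval_X_one, h, Polynomial.eval_zero]
  suffices X 1 * q = 0 from (mul_eq_zero.mp this).resolve_left (X_ne_zero 1)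
  refine MvPolynomial.funext fun v ↦ ?_
  rw [map_mul, eval_X, map_zero, mul_eq_zero, or_iff_not_imp_left]
  intro hv
  have : v = v 1 • ![v 0 / v 1, 1] := by
    ext i
    fin_cases i
    · simp [mul_div_cancel₀ _ hv]
    · simp
  rw [this, eval_smul_of_isHomogeneous hq, heval, mul_zero]

/-- A binary form of degree `n` vanishing at more than `n + 1` points of the projective line is
zero. -/
theorem eq_zero_of_isHomogeneous_of_card_lt {K : Type*} [Field K] [Infinite K]
    {q : MvPolynomial (Fin 2) K} {n : ℕ} (hq : q.IsHomogeneous n)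
    (S : Finset (Projectivization K (Fin 2 → K))) (hS : ∀ P ∈ S, eval P.rep q = 0)
    (hcard : n + 1 < S.card) : q = 0 := by
  classical
  refine eq_zero_of_aeval_X_one_eq_zero hq ?_
  set f := aeval ![(Polynomial.X : Polynomial K), 1] q
  have hdeg : f.natDegree ≤ n := by
    have := aeval_natDegree_le q hq.totalDegree_le ![(Polynomial.X : Polynomial K), 1]
      (n := 1) fun i ↦ by fin_cases i <;> simp
    simpa using this
  let T := S.filter fun P ↦ P.rep 1 ≠ 0
  have hT : n < T.card := by
    have hinf : (S.filter fun P ↦ P.rep 1 = 0).card ≤ 1 := Finset.card_le_one.mpr fun P hP Q hQ ↦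
      projectivization_eq_of_rep_one_eq_zero (Finset.mem_filter.mp hP).2 (Finset.mem_filter.mp hQ).2
    have := Finset.card_filter_add_card_filter_not (s := S) fun P ↦ P.rep 1 = 0
    change _ + T.card = _ at this
    omega
  refine Polynomial.eq_zero_of_natDegree_lt_card_of_eval_eq_zero' f
    (T.image fun P ↦ P.rep 0 / P.rep 1) ?_ ?_
  · simp only [Finset.forall_mem_image]
    intro P hP
    obtain ⟨hPS, hP1⟩ := Finset.mem_filter.mp hP
    have hv : ![P.rep 0 / P.rep 1, 1] = (P.rep 1)⁻¹ • P.rep := by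
      ext i
      fin_cases i
      · simp [div_eq_inv_mul]
      · simp [hP1]
    rw [eval_aeval_X_one, hv, eval_smul_of_isHomogeneous hq, hS P hPS, mul_zero]
  · rw [Finset.card_image_of_injOn]
    · exact hdeg.trans_lt hT
    · exact fun P hP Q hQ ↦ projectivization_eq_of_rep_div_eq
        (Finset.mem_filter.mp hP).2 (Finset.mem_filter.mp hQ).2

/-- A linear form vanishing at the image of `P` under `projMap p` vanishes on the values of `p`
at `P`. -/
theorem linear_form_eval_eq_zero {p : Fin 3 → MvPolynomial (Fin 2) ℂ}
    {P : Projectivization ℂ (Fin 2 → ℂ)} {L : (Fin 3 → ℂ) →ₗ[ℂ] ℂ}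
    (h : L (projMap p P).rep = 0) : L (fun i ↦ eval P.rep (p i)) = 0 := by
  by_cases h0 : (fun i ↦ eval P.rep (p i)) = 0
  · rw [h0, map_zero]
  · rw [projMap, dif_neg h0] at h
    obtain ⟨a, ha⟩ := Projectivization.exists_smul_eq_mk_rep ℂ _ h0
    rw [← ha, Units.smul_def, map_smul, smul_eq_mul] at h
    exact (mul_eq_zero.mp h).resolve_left a.ne_zero

/-- for linearly independent degree-4 binary forms `p₀, p₁, p₂` with no
common zero, if the induced map `θ` identifies three pairs of distinct parameters
`x₁,…,x₆` with three distinct image points `z₀, z₁, z₂` (the nodes), then `z₀, z₁, z₂`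
are not collinear: no nonzero linear form on `ℂ³` vanishes on representatives of all
three. -/
theorem statement6 (p : Fin 3 → MvPolynomial (Fin 2) ℂ)
    (hp : ∀ i, (p i).IsHomogeneous 4)
    (hli : LinearIndependent ℂ p)
    (hnc : ∀ v : Fin 2 → ℂ, v ≠ 0 → ∃ i, eval v (p i) ≠ 0)
    (x : Fin 6 → Projectivization ℂ (Fin 2 → ℂ)) (hx : Function.Injective x)
    (z : Fin 3 → Projectivization ℂ (Fin 3 → ℂ)) (hz : Function.Injective z)
    (h01 : projMap p (x 0) = z 0) (h02 : projMap p (x 1) = z 0)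
    (h11 : projMap p (x 2) = z 1) (h12 : projMap p (x 3) = z 1)
    (h21 : projMap p (x 4) = z 2) (h22 : projMap p (x 5) = z 2) :
    ¬ ∃ L : (Fin 3 → ℂ) →ₗ[ℂ] ℂ, L ≠ 0 ∧ ∀ j : Fin 3, L (z j).rep = 0 := by
  rintro ⟨L, hL, hLz⟩
  have hLx (k : Fin 6) : L (projMap p (x k)).rep = 0 := by
    fin_cases k <;>
      simp only [Fin.zero_eta, Fin.mk_one, Fin.reduceFinMk, h01, h02, h11, h12, h21, h22, hLz]
  let c : Fin 3 → ℂ := fun i ↦ L (Pi.single i 1)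
  let q : MvPolynomial (Fin 2) ℂ := ∑ i, c i • p i
  have hq : q.IsHomogeneous 4 := IsHomogeneous.sum _ _ _ fun i _ ↦ by
    simpa [smul_eq_C_mul] using (isHomogeneous_C _ (c i)).mul (hp i)
  have hqx (v : Fin 2 → ℂ) : eval v q = L fun i ↦ eval v (p i) := by
    rw [LinearMap.pi_apply_eq_sum_univ L]
    simp only [q, c, map_sum, smul_eval]
    refine Finset.sum_congr rfl fun i _ ↦ ?_
    rw [mul_comm, smul_eq_mul]
    congr 2
    ext j
    simp [Pi.single_apply, eq_comm]
  have hq0 : q = 0 := by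
    refine eq_zero_of_isHomogeneous_of_card_lt hq (Finset.univ.map ⟨x, hx⟩) ?_ (by simp)
    intro P hP
    obtain ⟨k, -, rfl⟩ := Finset.mem_map.mp hP
    rw [hqx]
    exact linear_form_eval_eq_zero (hLx k)
  refine hL (LinearMap.pi_ext' fun i ↦ LinearMap.ext_ring ?_)
  simpa using Fintype.linearIndependent_iff.mp hli c hq0 i
end

section
/- Let p_0, p_1, p_2 be binary forms of degree 4 over ℂ with no common zero in ℙ¹(ℂ), and let θ : ℙ¹(ℂ) → ℙ²(ℂ) be the induced map. Suppose the set D = { {x, y} : x, y ∈ ℙ¹(ℂ), x ≠ y, θ(x) = θ(y) } of unordered pairs of distinct parameters identified by θ is finite. Then D has at most 3 elements; i.e., a rational plane curve of degree 4 has at most 3 double points. -/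
open MvPolynomial

open Polynomial in
/-- If the Wronskian of `f ≠ 0` and `g` vanishes, every root of `f` is a root of `g`. -/
theorem Polynomial.isRoot_of_wronskian_eq_zero {f g : ℂ[X]} {t : ℂ} (hf : f ≠ 0)
    (hft : f.IsRoot t) (h : wronskian f g = 0) : g.IsRoot t := by
  by_contra hgt
  have hg : g ≠ 0 := by rintro rfl; exact hgt (by simp)
  have hmul : f * derivative g = derivative f * g := by
    rw [wronskian] at h; linear_combination h
  have hf' : derivative f ≠ 0 := by
    intro h0
    have := derivative_eq_zero.1 h0
    rw [eq_C_of_natDegree_eq_zero this] at hft hf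
    simp at hft
    simp [hft] at hf
  have hd := derivative_rootMultiplicity_of_root hft
  have hpos := (rootMultiplicity_pos hf).2 hft
  have hg' : derivative g ≠ 0 := by
    intro h0
    rw [h0, mul_zero] at hmul
    exact mul_ne_zero hf' hg hmul.symm
  have h1 := rootMultiplicity_mul (x := t) (mul_ne_zero hf hg')
  have h2 := rootMultiplicity_mul (x := t) (mul_ne_zero hf' hg)
  rw [rootMultiplicity_eq_zero hgt] at h2
  rw [hmul] at h1
  omega

namespace PlaneQuartic

local notation "ℙ¹" => Projectivization ℂ (Fin 2 → ℂ)

/-- The values at `v` of the monomials `s ^ (4 - k) * t ^ k`. -/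
def veronese (v : Fin 2 → ℂ) : Fin 5 → ℂ :=
  ![v 0 ^ 4, v 0 ^ 3 * v 1, v 0 ^ 2 * v 1 ^ 2, v 0 * v 1 ^ 3, v 1 ^ 4]

/-- The functional `w` on quartic forms kills every multiple of the quadratic form with
roots `x` and `y`. -/
def Apolar (x y : Fin 2 → ℂ) (w : Fin 5 → ℂ) : Prop :=
  x 1 * y 1 * w 0 - (x 1 * y 0 + x 0 * y 1) * w 1 + x 0 * y 0 * w 2 = 0 ∧
  x 1 * y 1 * w 1 - (x 1 * y 0 + x 0 * y 1) * w 2 + x 0 * y 0 * w 3 = 0 ∧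
  x 1 * y 1 * w 2 - (x 1 * y 0 + x 0 * y 1) * w 3 + x 0 * y 0 * w 4 = 0

/-- The determinant of the Hankel matrix of a functional on quartic forms. -/
def catalecticant (w : Fin 5 → ℂ) : ℂ :=
  w 0 * w 2 * w 4 + 2 * w 1 * w 2 * w 3 - w 2 ^ 3 - w 0 * w 3 ^ 2 - w 1 ^ 2 * w 4

theorem Apolar.symm {x y : Fin 2 → ℂ} {w : Fin 5 → ℂ} (h : Apolar x y w) : Apolar y x w := by
  obtain ⟨h0, h1, h2⟩ := h
  exact ⟨by linear_combination h0, by linear_combination h1, by linear_combination h2⟩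

theorem Apolar.smul {x y : Fin 2 → ℂ} {w : Fin 5 → ℂ} (h : Apolar x y w) (a b : ℂ) :
    Apolar (a • x) (b • y) w := by
  obtain ⟨h0, h1, h2⟩ := h
  simp only [Apolar, Pi.smul_apply, smul_eq_mul]
  exact ⟨by linear_combination a * b * h0, by linear_combination a * b * h1,
    by linear_combination a * b * h2⟩

theorem exists_apolar_vectors {w : Fin 5 → ℂ} (h : catalecticant w = 0) :
    ∃ x y : Fin 2 → ℂ, x ≠ 0 ∧ y ≠ 0 ∧ Apolar x y w := by
  let H : Matrix (Fin 3) (Fin 3) ℂ := !![w 0, w 1, w 2; w 1, w 2, w 3; w 2, w 3, w 4]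
  have hH : H.det = 0 := by
    simp only [H, Matrix.det_fin_three, Matrix.of_apply, Matrix.cons_val]
    rw [catalecticant] at h
    linear_combination h
  obtain ⟨q, hq, hHq⟩ := Matrix.exists_mulVec_eq_zero_iff.2 hH
  have h0 : w 0 * q 0 + w 1 * q 1 + w 2 * q 2 = 0 := by
    simpa [H, Matrix.mulVec, dotProduct, Fin.sum_univ_three] using congrFun hHq 0
  have h1 : w 1 * q 0 + w 2 * q 1 + w 3 * q 2 = 0 := by
    simpa [H, Matrix.mulVec, dotProduct, Fin.sum_univ_three] using congrFun hHq 1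
  have h2 : w 2 * q 0 + w 3 * q 1 + w 4 * q 2 = 0 := by
    simpa [H, Matrix.mulVec, dotProduct, Fin.sum_univ_three] using congrFun hHq 2
  by_cases ha : q 0 = 0
  · refine ⟨![1, 0], ![-q 2, q 1], by simp, ?_, ?_⟩
    · intro hy
      apply hq
      have e0 := congrFun hy 0
      have e1 := congrFun hy 1
      simp at e0 e1
      ext i; fin_cases i <;> simp [ha, e0, e1]
    · rw [ha] at h0 h1 h2
      simp only [Apolar, Matrix.cons_val_zero, Matrix.cons_val_one]
      exact ⟨by linear_combination -h0, by linear_combination -h1, by linear_combination -h2⟩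
  · obtain ⟨d, hd⟩ := IsAlgClosed.exists_pow_nat_eq (discrim (q 0) (q 1) (q 2)) two_pos
    obtain ⟨r, hr⟩ := exists_quadratic_eq_zero ha ⟨d, by rw [← hd, sq]⟩
    refine ⟨![r, 1], ![-(q 1 + q 0 * r), q 0], by simp, ?_, ?_⟩
    · intro hy
      exact ha (by simpa using congrFun hy 1)
    · simp only [Apolar, Matrix.cons_val_zero, Matrix.cons_val_one]
      exact ⟨by linear_combination h0 - w 2 * hr, by linear_combination h1 - w 3 * hr,
        by linear_combination h2 - w 4 * hr⟩

theorem exists_apolar {w : Fin 5 → ℂ} (h : catalecticant w = 0) :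
    ∃ x y : ℙ¹, Apolar x.rep y.rep w := by
  obtain ⟨x, y, hx, hy, hxy⟩ := exists_apolar_vectors h
  obtain ⟨a, ha⟩ := Projectivization.exists_smul_eq_mk_rep ℂ x hx
  obtain ⟨b, hb⟩ := Projectivization.exists_smul_eq_mk_rep ℂ y hy
  refine ⟨.mk ℂ x hx, .mk ℂ y hy, ?_⟩
  rw [← ha, ← hb]
  exact hxy.smul (a : ℂ) (b : ℂ)

theorem exists_geometric_three {x : Fin 2 → ℂ} (hx : x ≠ 0) {u : Fin 4 → ℂ}
    (h : ∀ k : Fin 3, x 1 * u k.castSucc = x 0 * u k.succ) :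
    ∃ c : ℂ, u = c • ![x 0 ^ 3, x 0 ^ 2 * x 1, x 0 * x 1 ^ 2, x 1 ^ 3] := by
  have h0 : x 1 * u 0 = x 0 * u 1 := h 0
  have h1 : x 1 * u 1 = x 0 * u 2 := h 1
  have h2 : x 1 * u 2 = x 0 * u 3 := h 2
  by_cases hx0 : x 0 = 0
  · have hx1 : x 1 ≠ 0 := by
      intro hx1; apply hx; ext i; fin_cases i <;> simp [hx0, hx1]
    refine ⟨u 3 / x 1 ^ 3, ?_⟩
    simp only [hx0, zero_mul, mul_eq_zero, hx1, false_or] at h0 h1 h2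
    ext i; fin_cases i <;> simp [hx0, hx1, h0, h1, h2]
  · refine ⟨u 0 / x 0 ^ 3, ?_⟩
    have e1 : u 1 = u 0 * x 1 / x 0 := by field_simp; linear_combination -h0
    have e2 : u 2 = u 1 * x 1 / x 0 := by field_simp; linear_combination -h1
    have e3 : u 3 = u 2 * x 1 / x 0 := by field_simp; linear_combination -h2
    rw [e1] at e2; rw [e2] at e3
    ext i; fin_cases i <;> simp [e1, e2, e3] <;> field_simp

theorem exists_geometric_four {x : Fin 2 → ℂ} (hx : x ≠ 0) {u : Fin 5 → ℂ}
    (h : ∀ k : Fin 4, x 1 * u k.castSucc = x 0 * u k.succ) :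
    ∃ c : ℂ, u = c • veronese x := by
  have h0 : x 1 * u 0 = x 0 * u 1 := h 0
  have h1 : x 1 * u 1 = x 0 * u 2 := h 1
  have h2 : x 1 * u 2 = x 0 * u 3 := h 2
  have h3 : x 1 * u 3 = x 0 * u 4 := h 3
  by_cases hx0 : x 0 = 0
  · have hx1 : x 1 ≠ 0 := by
      intro hx1; apply hx; ext i; fin_cases i <;> simp [hx0, hx1]
    refine ⟨u 4 / x 1 ^ 4, ?_⟩
    simp only [hx0, zero_mul, mul_eq_zero, hx1, false_or] at h0 h1 h2 h3
    ext i; fin_cases i <;> simp [veronese, hx0, hx1, h0, h1, h2, h3]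
  · refine ⟨u 0 / x 0 ^ 4, ?_⟩
    have e1 : u 1 = u 0 * x 1 / x 0 := by field_simp; linear_combination -h0
    have e2 : u 2 = u 1 * x 1 / x 0 := by field_simp; linear_combination -h1
    have e3 : u 3 = u 2 * x 1 / x 0 := by field_simp; linear_combination -h2
    have e4 : u 4 = u 3 * x 1 / x 0 := by field_simp; linear_combination -h3
    rw [e1] at e2; rw [e2] at e3; rw [e3] at e4
    ext i; fin_cases i <;> simp [veronese, e1, e2, e3, e4] <;> field_simp

theorem Apolar.exists_contract {x y : Fin 2 → ℂ} {w : Fin 5 → ℂ} (hx : x ≠ 0)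
    (h : Apolar x y w) :
    ∃ c, y 1 * w 0 - y 0 * w 1 = c * x 0 ^ 3 ∧ y 1 * w 1 - y 0 * w 2 = c * (x 0 ^ 2 * x 1) ∧
      y 1 * w 2 - y 0 * w 3 = c * (x 0 * x 1 ^ 2) ∧ y 1 * w 3 - y 0 * w 4 = c * x 1 ^ 3 := by
  obtain ⟨h0, h1, h2⟩ := h
  obtain ⟨c, hc⟩ := exists_geometric_three hx
    (u := fun k => y 1 * w k.castSucc - y 0 * w k.succ) (by
      intro k
      fin_cases k
      · exact (by linear_combination h0 :
          x 1 * (y 1 * w 0 - y 0 * w 1) = x 0 * (y 1 * w 1 - y 0 * w 2))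
      · exact (by linear_combination h1 :
          x 1 * (y 1 * w 1 - y 0 * w 2) = x 0 * (y 1 * w 2 - y 0 * w 3))
      · exact (by linear_combination h2 :
          x 1 * (y 1 * w 2 - y 0 * w 3) = x 0 * (y 1 * w 3 - y 0 * w 4)))
  exact ⟨c, congrFun hc 0, congrFun hc 1, congrFun hc 2, congrFun hc 3⟩

theorem Apolar.exists_eq_add {x y : Fin 2 → ℂ} {w : Fin 5 → ℂ} (hx : x ≠ 0) (hy : y ≠ 0)
    (hxy : x 0 * y 1 - x 1 * y 0 ≠ 0) (h : Apolar x y w) :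
    ∃ a b : ℂ, w = a • veronese x + b • veronese y := by
  obtain ⟨c, c0, c1, c2, c3⟩ := h.exists_contract hx
  obtain ⟨d, d0, d1, d2, d3⟩ := h.symm.exists_contract hy
  refine ⟨c / (x 0 * y 1 - x 1 * y 0), -d / (x 0 * y 1 - x 1 * y 0), ?_⟩
  ext i
  fin_cases i <;> simp [veronese] <;> field_simp
  · linear_combination x 0 * c0 - y 0 * d0
  · linear_combination x 0 * c1 - y 0 * d1
  · linear_combination x 0 * c2 - y 0 * d2
  · linear_combination x 0 * c3 - y 0 * d3
  · linear_combination x 1 * c3 - y 1 * d3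

theorem det_rep_ne_zero {x y : ℙ¹} (h : x ≠ y) :
    x.rep 0 * y.rep 1 - x.rep 1 * y.rep 0 ≠ 0 := by
  intro h0
  apply h
  rw [← x.mk_rep, ← y.mk_rep, Projectivization.mk_eq_mk_iff']
  have hy := y.rep_nonzero
  by_cases hy0 : y.rep 0 = 0
  · have hy1 : y.rep 1 ≠ 0 := by
      intro hy1; apply hy; ext i; fin_cases i <;> simp [hy0, hy1]
    refine ⟨x.rep 1 / y.rep 1, ?_⟩
    ext i; fin_cases i
    · simp only [hy0, mul_zero, sub_zero, mul_eq_zero, hy1, or_false] at h0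
      simp [hy0, h0]
    · simp [hy1]
  · refine ⟨x.rep 0 / y.rep 0, ?_⟩
    ext i; fin_cases i
    · simp [hy0]
    · simp; field_simp; linear_combination h0

section

variable {A : Matrix (Fin 3) (Fin 5) ℂ}

theorem eq_zero_of_contract_eq_zero
    (hA : ∀ v : Fin 2 → ℂ, v ≠ 0 → A.mulVec (veronese v) ≠ 0)
    {y : Fin 2 → ℂ} (hy : y ≠ 0) {w : Fin 5 → ℂ}
    (hw : A.mulVec w = 0) (h : ∀ k : Fin 4, y 1 * w k.castSucc = y 0 * w k.succ) : w = 0 := by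
  obtain ⟨c, rfl⟩ := exists_geometric_four hy h
  rw [Matrix.mulVec_smul, smul_eq_zero] at hw
  rw [hw.resolve_right (hA y hy), zero_smul]

/-- Two annihilating functionals killing the multiples of the same quadratic form are
proportional. -/
theorem Apolar.not_linearIndependent
    (hA : ∀ v : Fin 2 → ℂ, v ≠ 0 → A.mulVec (veronese v) ≠ 0)
    {x y : Fin 2 → ℂ} (hx : x ≠ 0) (hy : y ≠ 0)
    {w w' : Fin 5 → ℂ} (hw : A.mulVec w = 0) (hw' : A.mulVec w' = 0)
    (h : Apolar x y w) (h' : Apolar x y w') : ¬ LinearIndependent ℂ ![w, w'] := by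
  intro hli
  obtain ⟨c, c0, c1, c2, c3⟩ := h.exists_contract hx
  obtain ⟨d, d0, d1, d2, d3⟩ := h'.exists_contract hx
  rw [LinearIndependent.pair_iff] at hli
  have key : d • w + (-c) • w' = 0 := by
    apply eq_zero_of_contract_eq_zero hA hy
    · rw [Matrix.mulVec_add, Matrix.mulVec_smul, Matrix.mulVec_smul, hw, hw']; simp
    · intro k
      fin_cases k <;> simp
      · linear_combination d * c0 - c * d0
      · linear_combination d * c1 - c * d1
      · linear_combination d * c2 - c * d2
      · linear_combination d * c3 - c * d3
  obtain ⟨-, hc⟩ := hli _ _ key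
  have hc : c = 0 := by simpa using hc
  subst hc
  have hw0 : w = 0 := by
    apply eq_zero_of_contract_eq_zero hA hy hw
    intro k
    fin_cases k <;> simp
    · linear_combination c0
    · linear_combination c1
    · linear_combination c2
    · linear_combination c3
  exact one_ne_zero (hli 1 0 (by simp [hw0])).1

end

/-- The restriction to the affine chart `![1, t]` of the form with coefficients `A i`. -/
noncomputable def affineForm (A : Matrix (Fin 3) (Fin 5) ℂ) (i : Fin 3) : Polynomial ℂ :=
  ∑ k : Fin 5, Polynomial.C (A i k) * Polynomial.X ^ (k : ℕ)

theorem eval_affineForm (A : Matrix (Fin 3) (Fin 5) ℂ) (i : Fin 3) (t : ℂ) :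
    (affineForm A i).eval t = A.mulVec (veronese ![1, t]) i := by
  simp [affineForm, Matrix.mulVec, dotProduct, veronese, Fin.sum_univ_five]

theorem eval_derivative_affineForm (A : Matrix (Fin 3) (Fin 5) ℂ) (i : Fin 3) (t : ℂ) :
    (affineForm A i).derivative.eval t =
      A i 1 + A i 2 * (2 * t) + A i 3 * (3 * t ^ 2) + A i 4 * (4 * t ^ 3) := by
  simp [affineForm, Fin.sum_univ_five]
  ring

/-- The pairs of distinct parameters identified by the map with coefficient matrix `A`. -/
def doublePoints (A : Matrix (Fin 3) (Fin 5) ℂ) : Set (Set ℙ¹) :=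
  {s | ∃ x y, x ≠ y ∧
    (∃ a : ℂ, a ≠ 0 ∧ A.mulVec (veronese x.rep) = a • A.mulVec (veronese y.rep)) ∧ s = {x, y}}

section

variable {A : Matrix (Fin 3) (Fin 5) ℂ}

theorem exists_wronskian_affineForm_ne_zero
    (hA : ∀ v : Fin 2 → ℂ, v ≠ 0 → A.mulVec (veronese v) ≠ 0) :
    ∃ i j, (affineForm A i).wronskian (affineForm A j) ≠ 0 := by
  by_contra! h
  by_cases hroot : ∃ j t, affineForm A j ≠ 0 ∧ (affineForm A j).IsRoot t
  · obtain ⟨j, t, hj, ht⟩ := hroot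
    refine hA ![1, t] (by simp) ?_
    ext i
    rw [← eval_affineForm]
    exact Polynomial.isRoot_of_wronskian_eq_zero hj ht (h j i)
  · push Not at hroot
    refine hA ![0, 1] (by simp) ?_
    ext i
    have hdeg : (affineForm A i).degree ≤ 0 := by
      by_contra hdeg
      obtain ⟨t, ht⟩ := IsAlgClosed.exists_root (affineForm A i) (fun h0 => hdeg h0.le)
      refine hroot i t ?_ ht
      intro h0
      simp [h0] at hdeg
    have h4 : (affineForm A i).coeff 4 = 0 :=
      Polynomial.coeff_eq_zero_of_degree_lt (hdeg.trans_lt (by norm_num))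
    have h4' : (affineForm A i).coeff 4 = A i 4 := by
      simp [affineForm, Fin.sum_univ_five]
    simp [Matrix.mulVec, dotProduct, veronese, Fin.sum_univ_five, ← h4', h4]

theorem Apolar.wronskian_isRoot {x : Fin 2 → ℂ} (hx : x 0 ≠ 0) {w : Fin 5 → ℂ} (hw0 : w ≠ 0)
    (hw : A.mulVec w = 0) (h : Apolar x x w) (i j : Fin 3) :
    ((affineForm A i).wronskian (affineForm A j)).IsRoot (x 1 / x 0) := by
  obtain ⟨h0, h1, h2⟩ := h
  set t := x 1 / x 0 with ht
  have hx1 : x 1 = t * x 0 := by rw [ht]; field_simp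
  rw [hx1] at h0 h1 h2
  have hsq : x 0 ^ 2 ≠ 0 := pow_ne_zero _ hx
  obtain ⟨g, hg⟩ : ∃ g, g = w 1 - t * w 0 := ⟨_, rfl⟩
  have e1 : w 1 = t * w 0 + g := by rw [hg]; ring
  have e2 : w 2 = t ^ 2 * w 0 + 2 * t * g := by
    apply mul_left_cancel₀ hsq
    linear_combination h0 + 2 * t * x 0 ^ 2 * e1
  have e3 : w 3 = t ^ 3 * w 0 + 3 * t ^ 2 * g := by
    apply mul_left_cancel₀ hsq
    linear_combination h1 + 2 * t * x 0 ^ 2 * e2 - t ^ 2 * x 0 ^ 2 * e1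
  have e4 : w 4 = t ^ 4 * w 0 + 4 * t ^ 3 * g := by
    apply mul_left_cancel₀ hsq
    linear_combination h2 + 2 * t * x 0 ^ 2 * e3 - t ^ 2 * x 0 ^ 2 * e2
  have key (i : Fin 3) :
      w 0 * (affineForm A i).eval t + g * (affineForm A i).derivative.eval t = 0 := by
    have hi := congrFun hw i
    simp only [Matrix.mulVec, dotProduct, Fin.sum_univ_five, Pi.zero_apply] at hi
    rw [eval_derivative_affineForm, eval_affineForm]
    simp only [Matrix.mulVec, dotProduct, Fin.sum_univ_five, veronese, Matrix.cons_val]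
    rw [e1, e2, e3, e4] at hi
    linear_combination hi
  have hne : w 0 ≠ 0 ∨ g ≠ 0 := by
    by_contra! hn
    obtain ⟨hn0, rfl⟩ := hn
    apply hw0
    ext k
    fin_cases k <;> simp [hn0, e1, e2, e3, e4]
  simp only [Polynomial.wronskian, Polynomial.IsRoot.def, Polynomial.eval_sub,
    Polynomial.eval_mul]
  rcases hne with hne | hne
  · apply mul_left_cancel₀ hne
    linear_combination (Polynomial.eval t (Polynomial.derivative (affineForm A j))) * key i -
      (Polynomial.eval t (Polynomial.derivative (affineForm A i))) * key j
  · apply mul_left_cancel₀ hne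
    linear_combination (Polynomial.eval t (affineForm A i)) * key j -
      (Polynomial.eval t (affineForm A j)) * key i

theorem Apolar.pair_mem_doublePoints
    (hA : ∀ v : Fin 2 → ℂ, v ≠ 0 → A.mulVec (veronese v) ≠ 0)
    {x y : ℙ¹} (hxy : x ≠ y) {w : Fin 5 → ℂ} (hw0 : w ≠ 0)
    (hw : A.mulVec w = 0) (h : Apolar x.rep y.rep w) : {x, y} ∈ doublePoints A := by
  obtain ⟨a, b, rfl⟩ := h.exists_eq_add x.rep_nonzero y.rep_nonzero (det_rep_ne_zero hxy)
  rw [Matrix.mulVec_add, Matrix.mulVec_smul, Matrix.mulVec_smul] at hw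
  have ha : a ≠ 0 := by
    rintro rfl
    rw [zero_smul, zero_add, smul_eq_zero] at hw
    exact hw0 (by rw [hw.resolve_right (hA _ y.rep_nonzero)]; simp)
  have hb : b ≠ 0 := by
    rintro rfl
    rw [zero_smul, add_zero, smul_eq_zero] at hw
    exact hw0 (by rw [hw.resolve_right (hA _ x.rep_nonzero)]; simp)
  refine ⟨x, y, hxy, ⟨-b / a, div_ne_zero (neg_ne_zero.2 hb) ha, ?_⟩, rfl⟩
  ext i
  have hi := congrFun hw i
  simp at hi ⊢
  field_simp
  linear_combination hi

theorem infinite_doublePoints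
    (hA : ∀ v : Fin 2 → ℂ, v ≠ 0 → A.mulVec (veronese v) ≠ 0)
    {w : ℂ → Fin 5 → ℂ} (hw : ∀ c, A.mulVec (w c) = 0)
    (hcat : ∀ c, catalecticant (w c) = 0)
    (hli : ∀ c d, c ≠ d → LinearIndependent ℂ ![w c, w d]) : (doublePoints A).Infinite := by
  choose x y hxy using fun c => exists_apolar (hcat c)
  have hinj : Function.Injective fun c => ({x c, y c} : Set ℙ¹) := by
    intro c d hcd
    by_contra hne
    have hd : Apolar (x c).rep (y c).rep (w d) := by
      rcases Set.pair_eq_pair_iff.1 hcd with ⟨h1, h2⟩ | ⟨h1, h2⟩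
      · rw [h1, h2]; exact hxy d
      · rw [h1, h2]; exact (hxy d).symm
    exact Apolar.not_linearIndependent hA (x c).rep_nonzero (y c).rep_nonzero (hw c) (hw d)
      (hxy c) hd (hli c d hne)
  have hw0 (c : ℂ) : w c ≠ 0 := (hli c (c + 1) (by simp)).ne_zero 0
  obtain ⟨i, j, hij⟩ := exists_wronskian_affineForm_ne_zero hA
  intro hfin
  refine Set.infinite_range_of_injective hinj <| ((hfin.union
    (((Polynomial.rootSet_finite ((affineForm A i).wronskian (affineForm A j)) ℂ).image
      fun t => ({Projectivization.mk ℂ ![1, t] (by simp)} : Set ℙ¹)))).union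
    (Set.finite_singleton {Projectivization.mk ℂ ![0, 1] (by simp)})).subset ?_
  rintro _ ⟨c, rfl⟩
  by_cases hc : x c = y c
  · have hx := hxy c
    simp only [← hc, Set.pair_eq_singleton] at hx ⊢
    by_cases h0 : (x c).rep 0 = 0
    · right
      rw [Set.mem_singleton_iff, Set.singleton_eq_singleton_iff]
      nth_rw 1 [← (x c).mk_rep]
      rw [Projectivization.mk_eq_mk_iff']
      exact ⟨(x c).rep 1, by ext k; fin_cases k <;> simp [h0]⟩
    · refine Or.inl (Or.inr ⟨(x c).rep 1 / (x c).rep 0, ?_, ?_⟩)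
      · rw [Polynomial.mem_rootSet]
        refine ⟨hij, ?_⟩
        simpa using Apolar.wronskian_isRoot h0 (hw0 c) (hw c) hx i j
      · simp only [Set.singleton_eq_singleton_iff]
        refine Eq.trans ?_ (x c).mk_rep
        rw [Projectivization.mk_eq_mk_iff']
        refine ⟨((x c).rep 0)⁻¹, ?_⟩
        ext k
        fin_cases k
        · simp [h0]
        · simp; field_simp
  · exact Or.inl (Or.inl (Apolar.pair_mem_doublePoints hA hc (hw0 c) (hw c) (hxy c)))

end

/-- The coefficient of `a ^ 2 * b` in `catalecticant (a • u + b • v)`. -/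
def catalecticantPolar (u v : Fin 5 → ℂ) : ℂ :=
  v 0 * u 2 * u 4 + u 0 * v 2 * u 4 + u 0 * u 2 * v 4 +
    2 * (v 1 * u 2 * u 3 + u 1 * v 2 * u 3 + u 1 * u 2 * v 3) - 3 * u 2 ^ 2 * v 2 -
    v 0 * u 3 ^ 2 - 2 * u 0 * u 3 * v 3 - 2 * u 1 * v 1 * u 4 - u 1 ^ 2 * v 4

theorem catalecticant_smul_add_smul (a b : ℂ) (u v : Fin 5 → ℂ) :
    catalecticant (a • u + b • v) = a ^ 3 * catalecticant u + a ^ 2 * b * catalecticantPolar u v +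
      a * b ^ 2 * catalecticantPolar v u + b ^ 3 * catalecticant v := by
  simp only [catalecticant, catalecticantPolar, Pi.add_apply, Pi.smul_apply, smul_eq_mul]
  ring

theorem exists_catalecticant_eq_zero {u : Fin 5 → ℂ} (hu : catalecticant u ≠ 0)
    (v : Fin 5 → ℂ) : ∃ a : ℂ, catalecticant (a • u + v) = 0 := by
  obtain ⟨a, ha⟩ := IsAlgClosed.exists_root
    (.C (catalecticant u) * .X ^ 3 + .C (catalecticantPolar u v) * .X ^ 2 +
      .C (catalecticantPolar v u) * .X + .C (catalecticant v) : Polynomial ℂ)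
    (by rw [Polynomial.degree_cubic hu]; norm_num)
  refine ⟨a, ?_⟩
  have := catalecticant_smul_add_smul a 1 u v
  simp at ha
  rw [one_smul] at this
  rw [this]
  linear_combination ha

/-- A difference of two points of the rational normal quartic is a singular functional. -/
theorem catalecticant_veronese_sub (x y : Fin 2 → ℂ) (a : ℂ) :
    catalecticant (veronese x - a • veronese y) = 0 := by
  simp only [catalecticant, veronese, Pi.sub_apply, Pi.smul_apply, smul_eq_mul, Matrix.cons_val]
  ring

theorem coeff_eq_zero_of_veronese_relation {z y x' y' : ℙ¹} (hy : z ≠ y) (hx' : z ≠ x')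
    (hy' : z ≠ y') {a b c d : ℂ}
    (h : a • veronese z.rep + b • veronese y.rep + c • veronese x'.rep + d • veronese y'.rep = 0) :
    a = 0 := by
  have h0 := congrFun h 0
  have h1 := congrFun h 1
  have h2 := congrFun h 2
  have h3 := congrFun h 3
  have h4 := congrFun h 4
  simp only [veronese, Pi.add_apply, Pi.smul_apply, smul_eq_mul, Matrix.cons_val,
    Pi.zero_apply] at h0 h1 h2 h3 h4
  have hne := mul_ne_zero (mul_ne_zero (pow_ne_zero 2 (det_rep_ne_zero hy)) (det_rep_ne_zero hx'))
    (det_rep_ne_zero hy')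
  generalize z.rep = z, y.rep = y, x'.rep = x, y'.rep = t at *
  apply mul_right_cancel₀ hne
  linear_combination y 1 ^ 2 * (x 1 * t 1) * h0 +
    (-y 1 ^ 2 * (x 1 * t 0 + x 0 * t 1) - 2 * y 0 * y 1 * (x 1 * t 1)) * h1 +
    (y 1 ^ 2 * (x 0 * t 0) + 2 * y 0 * y 1 * (x 1 * t 0 + x 0 * t 1) + y 0 ^ 2 * (x 1 * t 1)) * h2 +
    (-2 * y 0 * y 1 * (x 0 * t 0) - y 0 ^ 2 * (x 1 * t 0 + x 0 * t 1)) * h3 +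
    y 0 ^ 2 * (x 0 * t 0) * h4

theorem left_eq_zero_of_pair_ne {x y x' y' : ℙ¹} (hxy : x ≠ y)
    (hne : ({x, y} : Set ℙ¹) ≠ {x', y'}) {a a' : ℂ} (ha : a ≠ 0) {s t : ℂ}
    (h : s • (veronese x.rep - a • veronese y.rep) +
      t • (veronese x'.rep - a' • veronese y'.rep) = 0) : s = 0 := by
  by_cases hx : x ≠ x' ∧ x ≠ y'
  · refine coeff_eq_zero_of_veronese_relation hxy hx.1 hx.2
      (b := -s * a) (c := t) (d := -t * a') ?_
    rw [← h]; module
  by_cases hy : y ≠ x' ∧ y ≠ y'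
  · have : -s * a = 0 := by
      refine coeff_eq_zero_of_veronese_relation hxy.symm hy.1 hy.2
        (b := s) (c := t) (d := -t * a') ?_
      rw [← h]; module
    simpa [ha] using this
  exfalso
  apply hne
  rw [Set.pair_eq_pair_iff]
  grind

theorem linearIndependent_of_pair_ne {x y x' y' : ℙ¹} (hxy : x ≠ y) (hxy' : x' ≠ y')
    (hne : ({x, y} : Set ℙ¹) ≠ {x', y'}) {a a' : ℂ} (ha : a ≠ 0) (ha' : a' ≠ 0) :
    LinearIndependent ℂ
      ![veronese x.rep - a • veronese y.rep, veronese x'.rep - a' • veronese y'.rep] := by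
  rw [LinearIndependent.pair_iff]
  intro s t h
  exact ⟨left_eq_zero_of_pair_ne hxy hne ha h,
    left_eq_zero_of_pair_ne hxy' hne.symm ha' (by rw [← h]; abel)⟩

/-- Among four pairwise independent singular annihilators, either the cubic `catalecticant`
vanishes on the span of the first two, or some third one lies outside that span; in either
case there are infinitely many. -/
theorem exists_singular_family {A : Matrix (Fin 3) (Fin 5) ℂ} {u : Fin 4 → Fin 5 → ℂ}
    (hu : ∀ i, A.mulVec (u i) = 0) (hcat : ∀ i, catalecticant (u i) = 0)
    (hli : ∀ i j, i ≠ j → LinearIndependent ℂ ![u i, u j]) :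
    ∃ w : ℂ → Fin 5 → ℂ, (∀ c, A.mulVec (w c) = 0) ∧ (∀ c, catalecticant (w c) = 0) ∧
      ∀ c d, c ≠ d → LinearIndependent ℂ ![w c, w d] := by
  simp only [LinearIndependent.pair_iff] at hli ⊢
  by_cases hline : ∀ c : ℂ, catalecticant (u 0 + c • u 1) = 0
  · refine ⟨fun c => u 0 + c • u 1, fun c => ?_, hline, fun c d hcd s t hst => ?_⟩
    · rw [Matrix.mulVec_add, Matrix.mulVec_smul, hu, hu]; simp
    · obtain ⟨h1, h2⟩ := hli 0 1 (by decide) (s + t) (s * c + t * d) (by rw [← hst]; module)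
      have hs : s = 0 := by
        apply mul_right_cancel₀ (sub_ne_zero.2 hcd)
        linear_combination h2 - d * h1
      exact ⟨hs, by simpa [hs] using h1⟩
  push Not at hline
  obtain ⟨c, hc⟩ := hline
  have hspan : ∃ k, ∀ a b : ℂ, u k ≠ a • u 0 + b • u 1 := by
    by_contra! h
    have hrel (k : Fin 4) (hk0 : k ≠ 0) (hk1 : k ≠ 1) :
        ∃ a b : ℂ, u k = a • u 0 + b • u 1 ∧ a ≠ 0 ∧
          a * catalecticantPolar (u 0) (u 1) + b * catalecticantPolar (u 1) (u 0) = 0 := by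
      obtain ⟨a, b, hab⟩ := h k
      have ha : a ≠ 0 := by
        rintro rfl
        have := (hli k 1 hk1 1 (-b) (by rw [hab]; module)).1
        exact one_ne_zero this
      have hb : b ≠ 0 := by
        rintro rfl
        have := (hli k 0 hk0 1 (-a) (by rw [hab]; module)).1
        exact one_ne_zero this
      refine ⟨a, b, hab, ha, ?_⟩
      have hk := hcat k
      rw [hab, catalecticant_smul_add_smul, hcat, hcat] at hk
      apply mul_left_cancel₀ (mul_ne_zero ha hb)
      linear_combination hk
    obtain ⟨a, b, hab, ha, h2⟩ := hrel 2 (by decide) (by decide)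
    obtain ⟨a', b', hab', ha', h3⟩ := hrel 3 (by decide) (by decide)
    have hdet : a' * b - a * b' ≠ 0 := by
      intro hdet
      refine ha' (hli 2 3 (by decide) a' (-a) ?_).1
      rw [hab, hab']
      have : a' • (a • u 0 + b • u 1) + -a • (a' • u 0 + b' • u 1) =
        (a' * b - a * b') • u 1 := by module
      rw [this, hdet, zero_smul]
    have hq : catalecticantPolar (u 1) (u 0) = 0 := by
      apply mul_left_cancel₀ hdet
      linear_combination a' * h2 - a * h3
    have hp : catalecticantPolar (u 0) (u 1) = 0 := by simpa [hq, ha] using h2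
    apply hc
    rw [← one_smul ℂ (u 0), catalecticant_smul_add_smul, hcat, hcat, hp, hq]
    ring
  obtain ⟨k, hk⟩ := hspan
  choose m hm using fun d : ℂ => exists_catalecticant_eq_zero hc (u 1 + d • u k)
  refine ⟨fun d => m d • (u 0 + c • u 1) + (u 1 + d • u k), fun d => ?_, hm,
    fun d e hde s t hst => ?_⟩
  · simp [Matrix.mulVec_add, Matrix.mulVec_smul, hu]
  · have hz : s * d + t * e = 0 := by
      by_contra hne
      refine hk (-(s * m d + t * m e) / (s * d + t * e))
        (-((s * m d + t * m e) * c + (s + t)) / (s * d + t * e)) ?_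
      ext l
      have hl := congrFun hst l
      simp at hl ⊢
      field_simp
      linear_combination hl
    obtain ⟨h1, h2⟩ := hli 0 1 (by decide) (s * m d + t * m e)
      ((s * m d + t * m e) * c + (s + t)) (by
        have : (s * m d + t * m e) • u 0 + ((s * m d + t * m e) * c + (s + t)) • u 1 =
          (s • (m d • (u 0 + c • u 1) + (u 1 + d • u k)) +
            t • (m e • (u 0 + c • u 1) + (u 1 + e • u k))) - (s * d + t * e) • u k := by module
        rw [this, hz, hst]; simp)
    rw [h1, zero_mul, zero_add] at h2
    have hs : s = 0 := by
      apply mul_right_cancel₀ (sub_ne_zero.2 hde)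
      linear_combination hz - e * h2
    exact ⟨hs, by simpa [hs] using h2⟩

theorem ncard_doublePoints_le {A : Matrix (Fin 3) (Fin 5) ℂ}
    (hA : ∀ v : Fin 2 → ℂ, v ≠ 0 → A.mulVec (veronese v) ≠ 0) (hfin : (doublePoints A).Finite) :
    (doublePoints A).ncard ≤ 3 := by
  by_contra! h
  rw [Set.ncard_eq_toFinset_card _ hfin] at h
  obtain ⟨T, hT, hcard⟩ := Finset.exists_subset_card_eq (Nat.succ_le_of_lt h)
  let e : Fin 4 ≃ T := (Finset.equivFinOfCardEq hcard).symm
  have hmem (i : Fin 4) : (e i : Set ℙ¹) ∈ doublePoints A := hfin.mem_toFinset.1 (hT (e i).2)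
  choose x y hxy hex hs using hmem
  choose a ha ha' using hex
  obtain ⟨w, hw, hcat, hli⟩ := exists_singular_family (A := A)
    (u := fun i => veronese (x i).rep - a i • veronese (y i).rep)
    (fun i => by rw [Matrix.mulVec_sub, Matrix.mulVec_smul, ha', sub_self])
    (fun i => catalecticant_veronese_sub _ _ _)
    (fun i j hij => linearIndependent_of_pair_ne (hxy i) (hxy j)
      (by rw [← hs, ← hs]; exact fun h => hij (e.injective (Subtype.ext h))) (ha i) (ha j))
  exact infinite_doublePoints hA hw hcat hli hfin

/-- The coefficients of three binary quartic forms. -/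
noncomputable def coeffMatrix (p : Fin 3 → MvPolynomial (Fin 2) ℂ) : Matrix (Fin 3) (Fin 5) ℂ :=
  fun i k => (p i).coeff (Finsupp.equivFunOnFinite.symm ![4 - (k : ℕ), k])

theorem eval_eq_mulVec_veronese {p : Fin 3 → MvPolynomial (Fin 2) ℂ}
    (hp : ∀ i, (p i).IsHomogeneous 4) (v : Fin 2 → ℂ) :
    (fun i => eval v (p i)) = (coeffMatrix p).mulVec (veronese v) := by
  ext i
  have hver (k : Fin 5) : veronese v k = v 0 ^ (4 - (k : ℕ)) * v 1 ^ (k : ℕ) := by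
    fin_cases k <;> simp [veronese]
  simp only [Matrix.mulVec, dotProduct, coeffMatrix, hver]
  have hinj : Function.Injective fun k : Fin 5 =>
      (Finsupp.equivFunOnFinite.symm ![4 - (k : ℕ), (k : ℕ)] : Fin 2 →₀ ℕ) := by
    intro k l hkl
    exact Fin.ext (by simpa using DFunLike.congr_fun hkl 1)
  rw [eval_eq']
  trans ∑ d ∈ Finset.univ.image fun k : Fin 5 =>
      (Finsupp.equivFunOnFinite.symm ![4 - (k : ℕ), (k : ℕ)] : Fin 2 →₀ ℕ),
      (p i).coeff d * ∏ l, v l ^ d l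
  · refine Finset.sum_subset (fun d hd => ?_) fun d _ hd => ?_
    · have hdeg : d 0 + d 1 = 4 := by
        have := hp i (mem_support_iff.1 hd)
        simpa [Finsupp.weight_apply, Finsupp.sum_fintype] using this
      refine Finset.mem_image.2 ⟨⟨d 1, by omega⟩, Finset.mem_univ _, ?_⟩
      ext l
      fin_cases l
      · simp; omega
      · simp
    · rw [notMem_support_iff.1 hd, zero_mul]
  · rw [Finset.sum_image hinj.injOn]
    simp [Fin.prod_univ_two]

end PlaneQuartic

theorem projMap_eq_iff {p : Fin 3 → MvPolynomial (Fin 2) ℂ}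
    (hnc : ∀ v : Fin 2 → ℂ, v ≠ 0 → ∃ i, eval v (p i) ≠ 0)
    (x y : Projectivization ℂ (Fin 2 → ℂ)) :
    projMap p x = projMap p y ↔
      ∃ a : ℂ, a ≠ 0 ∧ (fun i => eval x.rep (p i)) = a • fun i => eval y.rep (p i) := by
  have hne (z : Projectivization ℂ (Fin 2 → ℂ)) : (fun i => eval z.rep (p i)) ≠ 0 := by
    obtain ⟨i, hi⟩ := hnc z.rep z.rep_nonzero
    exact fun h => hi (congrFun h i)
  rw [projMap, projMap, dif_neg (hne x), dif_neg (hne y), Projectivization.mk_eq_mk_iff']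
  constructor
  · rintro ⟨a, ha⟩
    refine ⟨a, ?_, ha.symm⟩
    rintro rfl
    exact hne x (by rw [← ha, zero_smul])
  · rintro ⟨a, -, ha⟩
    exact ⟨a, ha.symm⟩

/-- for degree-4 binary forms `p₀, p₁, p₂` with no common zero, if the
set `D` of unordered pairs of distinct parameters identified by the induced map `θ`
is finite, then it has at most 3 elements: a rational plane quartic has at most 3
double points. -/
theorem statement8 (p : Fin 3 → MvPolynomial (Fin 2) ℂ)
    (hp : ∀ i, (p i).IsHomogeneous 4)
    (hnc : ∀ v : Fin 2 → ℂ, v ≠ 0 → ∃ i, eval v (p i) ≠ 0)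
    (hfin : {s : Set (Projectivization ℂ (Fin 2 → ℂ)) |
      ∃ x y, x ≠ y ∧ projMap p x = projMap p y ∧ s = {x, y}}.Finite) :
    {s : Set (Projectivization ℂ (Fin 2 → ℂ)) |
      ∃ x y, x ≠ y ∧ projMap p x = projMap p y ∧ s = {x, y}}.ncard ≤ 3 := by
  have hset : {s : Set (Projectivization ℂ (Fin 2 → ℂ)) |
      ∃ x y, x ≠ y ∧ projMap p x = projMap p y ∧ s = {x, y}} =
      PlaneQuartic.doublePoints (PlaneQuartic.coeffMatrix p) := by
    simp only [projMap_eq_iff hnc, PlaneQuartic.eval_eq_mulVec_veronese hp,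
      PlaneQuartic.doublePoints]
  rw [hset] at hfin ⊢
  refine PlaneQuartic.ncard_doublePoints_le (fun v hv h => ?_) hfin
  rw [← PlaneQuartic.eval_eq_mulVec_veronese hp] at h
  obtain ⟨i, hi⟩ := hnc v hv
  exact hi (congrFun h i)
end
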